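/- arXiv:2306.00178 — 2 statements merged into one kernel-verified Lean document; each statement's English description precedes it below -/
import Mathlib

section
/- Let ħ be a nonzero real number. On the complex vector space C^∞(ℝ,ℂ), let X̂ be the multiplication operator (X̂ψ)(x) = x·ψ(x) and P̂ the operator (P̂ψ)(x) = −iħ·ψ'(x). Then the linear operators (1/9)[X̂³, P̂³] and (1/3)[(1/3)(X̂²P̂ + X̂P̂X̂ + P̂X̂²), (1/3)(P̂²X̂ + P̂X̂P̂ + X̂P̂²)] are NOT equal; i.e., the Weyl quantizations of the two Poisson-bracket expressions (1/9){q³,p³} and (1/3){q²p,p²q}, both of which equal q²p² classically, give different operators. -/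
/-- The position operator `X̂` on complex-valued functions on `ℝ`: `(X̂ψ)(x) = x·ψ(x)`. -/
noncomputable def Xop : (ℝ → ℂ) → (ℝ → ℂ) := fun ψ x => (x : ℂ) * ψ x

/-- The momentum operator `P̂` on complex-valued functions on `ℝ`: `(P̂ψ)(x) = −ihbar·ψ'(x)`. -/
noncomputable def Pop (hbar : ℝ) : (ℝ → ℂ) → (ℝ → ℂ) := fun ψ x => -Complex.I * (hbar : ℂ) * deriv ψ x

/-- The commutator `[A,B] = AB − BA` of two operators. -/
noncomputable def commOp (A B : (ℝ → ℂ) → (ℝ → ℂ)) : (ℝ → ℂ) → (ℝ → ℂ) :=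
  fun ψ => A (B ψ) - B (A ψ)

/-- The Weyl quantization of `q³`, namely `X̂³`. -/
noncomputable def weylQ3 : (ℝ → ℂ) → (ℝ → ℂ) := fun ψ => Xop (Xop (Xop ψ))

/-- The Weyl quantization of `p³`, namely `P̂³`. -/
noncomputable def weylP3 (hbar : ℝ) : (ℝ → ℂ) → (ℝ → ℂ) := fun ψ => Pop hbar (Pop hbar (Pop hbar ψ))

/-- The Weyl quantization of `q²p`, namely `(1/3)(X̂²P̂ + X̂P̂X̂ + P̂X̂²)`. -/
noncomputable def weylQ2P (hbar : ℝ) : (ℝ → ℂ) → (ℝ → ℂ) :=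
  fun ψ => (1 / 3 : ℂ) • (Xop (Xop (Pop hbar ψ)) + Xop (Pop hbar (Xop ψ)) + Pop hbar (Xop (Xop ψ)))

/-- The Weyl quantization of `p²q`, namely `(1/3)(P̂²X̂ + P̂X̂P̂ + X̂P̂²)`. -/
noncomputable def weylP2Q (hbar : ℝ) : (ℝ → ℂ) → (ℝ → ℂ) :=
  fun ψ => (1 / 3 : ℂ) • (Pop hbar (Pop hbar (Xop ψ)) + Pop hbar (Xop (Pop hbar ψ)) + Xop (Pop hbar (Pop hbar ψ)))

/-- The monomial function `x ↦ a * x ^ n` of a real variable. -/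
noncomputable def realMonomial (a : ℂ) (n : ℕ) : ℝ → ℂ := fun x => a * (x : ℂ) ^ n

theorem Xop_realMonomial (a : ℂ) (n : ℕ) :
    Xop (realMonomial a n) = realMonomial a (n + 1) := by
  funext x
  simp only [Xop, realMonomial]
  ring

theorem Pop_realMonomial (hbar : ℝ) (a : ℂ) (n : ℕ) :
    Pop hbar (realMonomial a n) = realMonomial (-Complex.I * hbar * (a * n)) (n - 1) := by
  funext x
  have h : HasDerivAt (realMonomial a n) (a * (n * (x : ℂ) ^ (n - 1))) x :=
    ((hasDerivAt_pow n (x : ℂ)).const_mul a).comp_ofReal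
  simp only [Pop, h.deriv, realMonomial]
  ring

theorem realMonomial_add (a b : ℂ) (n : ℕ) :
    realMonomial a n + realMonomial b n = realMonomial (a + b) n := by
  funext x
  simp only [Pi.add_apply, realMonomial]
  ring

theorem smul_realMonomial (c a : ℂ) (n : ℕ) :
    c • realMonomial a n = realMonomial (c * a) n := by
  funext x
  simp only [Pi.smul_apply, smul_eq_mul, realMonomial]
  ring

theorem realMonomial_zero (n : ℕ) : realMonomial 0 n = 0 := by
  funext x
  simp [realMonomial]

theorem Xop_zero : Xop 0 = 0 := by
  funext x
  simp [Xop]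

theorem Pop_zero (hbar : ℝ) : Pop hbar 0 = 0 := by
  funext x
  simp [Pop]

theorem commOp_weylQ3_weylP3_one (hbar : ℝ) :
    commOp weylQ3 (weylP3 hbar) (realMonomial 1 0)
      = fun _ => -6 * (-Complex.I * hbar) ^ 3 := by
  funext x
  simp [commOp, weylQ3, weylP3, Xop_realMonomial, Pop_realMonomial, realMonomial_zero,
    Xop_zero, Pop_zero]
  simp only [realMonomial]
  ring

theorem commOp_weylQ2P_weylP2Q_one (hbar : ℝ) :
    commOp (weylQ2P hbar) (weylP2Q hbar) (realMonomial 1 0)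
      = fun _ => -(-Complex.I * hbar) ^ 3 := by
  funext x
  simp [commOp, weylQ2P, weylP2Q, Xop_realMonomial, Pop_realMonomial, realMonomial_zero,
    Xop_zero, Pop_zero, realMonomial_add, smul_realMonomial]
  simp only [realMonomial]
  ring

/-- The operators `(1/9)[X̂³, P̂³]` and
`(1/3)[(1/3)(X̂²P̂ + X̂P̂X̂ + P̂X̂²), (1/3)(P̂²X̂ + P̂X̂P̂ + X̂P̂²)]` are not equal as operators
on smooth complex-valued functions on `ℝ`: the Weyl quantizations of `(1/9){q³,p³}` and
`(1/3){q²p,p²q}` differ even though both classical expressions equal `q²p²`. -/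
theorem weyl_quantizations_of_q2p2_differ (hbar : ℝ) (hbar_ne : hbar ≠ 0) :
    ¬ ∀ ψ : ℝ → ℂ, ContDiff ℝ (⊤ : ℕ∞) ψ →
        (1 / 9 : ℂ) • commOp weylQ3 (weylP3 hbar) ψ
          = (1 / 3 : ℂ) • commOp (weylQ2P hbar) (weylP2Q hbar) ψ := by
  intro h
  have h_smooth : ContDiff ℝ (⊤ : ℕ∞) (realMonomial 1 0) := by
    unfold realMonomial
    simpa using contDiff_const
  have h_one := congrFun (h _ h_smooth) 0
  rw [commOp_weylQ3_weylP3_one, commOp_weylQ2P_weylP2Q_one] at h_one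
  simp only [Pi.smul_apply, smul_eq_mul] at h_one
  have h_cube : (-Complex.I * (hbar : ℂ)) ^ 3 = 0 := by linear_combination -3 * h_one
  simp [hbar_ne] at h_cube
end

section
/- Nonexistence of smooth polarized sections for the horizontal polarization on the cylinder: let ħ > 0 and suppose f : ℝ × ℝ → ℂ is continuous, differentiable in its first argument, satisfies the periodicity f(φ + 2π, p) = f(φ, p) for all (φ,p), and satisfies the polarization condition ∂f/∂φ(φ,p) = (i/ħ)·p·f(φ,p) for all (φ,p). Then f is identically zero. -/
/-- A differentiable solution of `g' = c g` on the line satisfies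
`g (x + t) = exp (t c) g x`. -/
theorem apply_add_eq_exp_mul_of_deriv_eq_mul {g : ℝ → ℂ} {c : ℂ} (hg : Differentiable ℝ g)
    (hderiv : ∀ x, deriv g x = c * g x) (x t : ℝ) :
    g (x + t) = Complex.exp (t * c) * g x := by
  have hconst : ∀ y, HasDerivAt (fun s : ℝ => Complex.exp (-(s * c)) * g s) 0 y := by
    intro y
    have hlin : HasDerivAt (fun s : ℝ => -((s : ℂ) * c)) (-(1 * c)) y :=
      (Complex.ofRealCLM.hasDerivAt.mul_const c).neg
    have hgy : HasDerivAt g (c * g y) y := hderiv y ▸ (hg y).hasDerivAt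
    refine (hlin.cexp.mul hgy).congr_deriv ?_
    ring
  have h := is_const_of_deriv_eq_zero (fun y => (hconst y).differentiableAt)
    (fun y => (hconst y).deriv) (x + t) x
  calc g (x + t)
      = Complex.exp ((x + t : ℝ) * c) * (Complex.exp (-((x + t : ℝ) * c)) * g (x + t)) := by
        rw [← mul_assoc, ← Complex.exp_add, add_neg_cancel, Complex.exp_zero, one_mul]
    _ = Complex.exp ((x + t : ℝ) * c) * (Complex.exp (-(x * c)) * g x) := by rw [h]
    _ = Complex.exp (t * c) * g x := by
        rw [← mul_assoc, ← Complex.exp_add]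
        congr 2
        push_cast
        ring

/-- A nonzero `2π`-periodic solution of `g' = (i/ħ) p g` exists only for `p ∈ ħℤ`
(the Bohr–Sommerfeld condition). -/
theorem exists_int_mul_eq_of_periodic_of_deriv_eq {hbar p : ℝ} (hbar_ne : hbar ≠ 0) {g : ℝ → ℂ}
    (hg : Differentiable ℝ g) (hper : Function.Periodic g (2 * Real.pi))
    (hderiv : ∀ x, deriv g x = Complex.I / (hbar : ℂ) * (p : ℂ) * g x)
    {x : ℝ} (hx : g x ≠ 0) : ∃ n : ℤ, n * hbar = p := by
  have h := apply_add_eq_exp_mul_of_deriv_eq_mul hg hderiv x (2 * Real.pi)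
  rw [hper x] at h
  obtain ⟨n, hn⟩ := Complex.exp_eq_one_iff.mp (mul_eq_right₀ hx |>.mp h.symm)
  refine ⟨n, ?_⟩
  have hbar_ne' : (hbar : ℂ) ≠ 0 := Complex.ofReal_ne_zero.mpr hbar_ne
  have hz : (n : ℂ) * hbar = p := by
    refine mul_left_cancel₀ Complex.two_pi_I_ne_zero ?_
    push_cast at hn
    field_simp at hn
    linear_combination (-2 * Real.pi * Complex.I) * hn
  exact_mod_cast hz

/-- Nonexistence of smooth polarized sections for the horizontal polarization on the cylinder
`T*S¹`: if `f : ℝ × ℝ → ℂ` (coordinates `(φ, p)`) is continuous, differentiable in its first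
argument, `2π`-periodic in `φ`, and satisfies the polarization condition
`∂f/∂φ = (i/ħ)·p·f`, then `f` is identically zero. -/
theorem cylinder_horizontal_polarization_no_sections
    (hbar : ℝ) (hbar_pos : 0 < hbar)
    (f : ℝ × ℝ → ℂ)
    (hcont : Continuous f)
    (hdiff : ∀ p : ℝ, Differentiable ℝ fun φ => f (φ, p))
    (hper : ∀ φ p : ℝ, f (φ + 2 * Real.pi, p) = f (φ, p))
    (hpol : ∀ φ p : ℝ, deriv (fun s => f (s, p)) φ
      = Complex.I / (hbar : ℂ) * (p : ℂ) * f (φ, p)) :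
    f = 0 := by
  have hdense : Dense (Set.range fun n : ℤ => (n : ℝ) * hbar)ᶜ :=
    (Set.countable_range _).dense_compl ℝ
  funext ⟨φ, p⟩
  have hslice : (fun q => f (φ, q)) = fun _ => 0 := by
    refine Continuous.ext_on hdense (by fun_prop) continuous_const fun q hq => ?_
    by_contra hne
    exact hq (exists_int_mul_eq_of_periodic_of_deriv_eq hbar_pos.ne' (hdiff q)
      (fun x => hper x q) (fun x => hpol x q) hne)
  exact congrFun hslice p
end
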